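/- Let l ≥ 4 be an integer, let G ∈ 𝒢_l, let C be an odd hole of G and, for i = 1, 2, let P_i be a short (u_i, v_i)-jump over C. If P1 and P2 are crossing, then G contains an odd K4-subdivision or a balanced K4-subdivision of type (1, 2). -/

import Mathlib

open SimpleGraph

variable {V : Type*}

/-- The set of internal vertices of a walk from `x` to `y`. -/
def wInterior {G : SimpleGraph V} {x y : V} (P : G.Walk x y) : Set V :=
  {a | a ∈ P.support ∧ a ≠ x ∧ a ≠ y}

/-- `P` is an induced path of `G`. -/
def IsInducedPath (G : SimpleGraph V) {x y : V} (P : G.Walk x y) : Prop :=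
  P.IsPath ∧ ∀ a ∈ P.support, ∀ b ∈ P.support, G.Adj a b → s(a, b) ∈ P.edges

/-- A hole of `G`: an induced cycle of length at least 4. -/
def IsHole (G : SimpleGraph V) {v : V} (w : G.Walk v v) : Prop :=
  w.IsCycle ∧ 4 ≤ w.length ∧
    ∀ a ∈ w.support, ∀ b ∈ w.support, G.Adj a b → s(a, b) ∈ w.edges

/-- An odd hole of `G`. -/
def IsOddHole (G : SimpleGraph V) {v : V} (w : G.Walk v v) : Prop :=
  IsHole G w ∧ Odd w.length

/-- `G` belongs to the family `𝒢ₗ`: it has girth `2l+1` and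
no odd hole of length at least `2l+3`. -/
def MemGFam (G : SimpleGraph V) (l : ℕ) : Prop :=
  G.girth = (2 * l + 1 : ℕ) ∧
    ∀ (v : V) (w : G.Walk v v), IsOddHole G w → w.length < 2 * l + 3

/-- `G` is `k`-vertex-critical. -/
def IsVertexCritical (G : SimpleGraph V) (k : ℕ) : Prop :=
  G.chromaticNumber = k ∧
    ∀ v : V, (G.induce {u | u ≠ v}).chromaticNumber < k

/-- `S` is a vertex cut of `G`: deleting `S` leaves a disconnected graph. -/
def IsVertexCut (G : SimpleGraph V) (S : Set V) : Prop :=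
  ¬ (G.induce Sᶜ).Preconnected

/-- `G` has a `K2`-cut. -/
def HasK2Cut (G : SimpleGraph V) : Prop :=
  ∃ u v : V, G.Adj u v ∧ IsVertexCut G {u, v}

/-- `G` has a `P3`-cut. -/
def HasP3Cut (G : SimpleGraph V) : Prop :=
  ∃ u v w : V, u ≠ w ∧ G.Adj u v ∧ G.Adj v w ∧ ¬ G.Adj u w ∧ IsVertexCut G {u, v, w}

/-- `G` has a 2-edge-cut: two edges whose removal disconnects the graph. -/
def Has2EdgeCut (G : SimpleGraph V) : Prop :=
  ∃ e f : Sym2 V, e ≠ f ∧ e ∈ G.edgeSet ∧ f ∈ G.edgeSet ∧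
    ¬ (G.deleteEdges {e, f}).Preconnected

/-- `Q1`, `Q2` are the two internally disjoint `(x,y)`-paths of the cycle `w`. -/
def ArcsOf (G : SimpleGraph V) {v x y : V} (w : G.Walk v v) (Q1 Q2 : G.Walk x y) : Prop :=
  x ∈ w.support ∧ y ∈ w.support ∧ x ≠ y ∧ Q1.IsPath ∧ Q2.IsPath ∧
    ({a | a ∈ Q1.support} ∩ {a | a ∈ Q2.support} = {x, y}) ∧
    ({e | e ∈ w.edges} = {e | e ∈ Q1.edges} ∪ {e | e ∈ Q2.edges})

/-- `P` is a chordal path of the hole `w`: `w ∪ P` is an induced theta-subgraph of `G`. -/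
def IsChordalPath (G : SimpleGraph V) {v x y : V} (w : G.Walk v v) (P : G.Walk x y) : Prop :=
  IsHole G w ∧ P.IsPath ∧ 2 ≤ P.length ∧ x ∈ w.support ∧ y ∈ w.support ∧ x ≠ y ∧
    (∀ a ∈ wInterior P, a ∉ w.support) ∧
    (∀ a, (a ∈ w.support ∨ a ∈ P.support) → ∀ b, (b ∈ w.support ∨ b ∈ P.support) →
      G.Adj a b → (s(a, b) ∈ w.edges ∨ s(a, b) ∈ P.edges))

/-- `P` is an `(s,t)`-jump over the hole `w`. -/
def IsJump (G : SimpleGraph V) {v s t : V} (w : G.Walk v v) (P : G.Walk s t) : Prop :=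
  IsHole G w ∧ s ∈ w.support ∧ t ∈ w.support ∧ s ≠ t ∧ ¬ G.Adj s t ∧
    IsInducedPath G P ∧ ∀ a ∈ wInterior P, a ∉ w.support

/-- `P` is a local jump over `w` across the interior of the arc `Q1`
(`Q1`, `Q2` being the two arcs of `w` between the ends of `P`). -/
def IsLocalJumpAcross (G : SimpleGraph V) {v s t : V} (w : G.Walk v v)
    (P Q1 Q2 : G.Walk s t) : Prop :=
  IsJump G w P ∧ ArcsOf G w Q1 Q2 ∧
    (∃ a ∈ wInterior Q1, ∃ b ∈ wInterior P, G.Adj a b) ∧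
    (∀ a ∈ wInterior Q2, ∀ b ∈ wInterior P, ¬ G.Adj a b)

/-- `P` is a local jump over `w`. -/
def IsLocalJump (G : SimpleGraph V) {v s t : V} (w : G.Walk v v) (P : G.Walk s t) : Prop :=
  ∃ Q1 Q2 : G.Walk s t, IsLocalJumpAcross G w P Q1 Q2

/-- `P` is a local jump over `w` across one vertex. -/
def IsLocalJumpAcrossOne (G : SimpleGraph V) {v s t : V} (w : G.Walk v v)
    (P : G.Walk s t) : Prop :=
  ∃ Q1 Q2 : G.Walk s t, IsLocalJumpAcross G w P Q1 Q2 ∧ Q1.length = 2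

/-- `P` is a short jump over `w`: no internal vertex of either arc of `w`
has a neighbour among the internal vertices of `P`. -/
def IsShortJump (G : SimpleGraph V) {v s t : V} (w : G.Walk v v) (P : G.Walk s t) : Prop :=
  IsJump G w P ∧
    ∀ a ∈ w.support, a ≠ s → a ≠ t → ∀ b ∈ wInterior P, ¬ G.Adj a b

/-- `P` is a short jump over `w` across the interior of `Q1`, i.e. `P ∪ Q1` is an
odd hole (a jump hole over `w`). -/
def IsShortJumpAcross (G : SimpleGraph V) {v s t : V} (w : G.Walk v v)
    (P Q1 Q2 : G.Walk s t) : Prop :=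
  IsShortJump G w P ∧ ArcsOf G w Q1 Q2 ∧ IsOddHole G (P.append Q1.reverse)

/-- `x` lies in some jump hole over `w`. -/
def InJumpHoleOver (G : SimpleGraph V) {v : V} (w : G.Walk v v) (x : V) : Prop :=
  ∃ (s t : V) (P Q1 Q2 : G.Walk s t),
    IsShortJumpAcross G w P Q1 Q2 ∧ (x ∈ P.support ∨ x ∈ Q1.support)

/-- `a`, `b`, `c`, `d` appear on the cycle `w` in this cyclic order. -/
def CyclicOrder4 (G : SimpleGraph V) {v : V} (w : G.Walk v v) (a b c d : V) : Prop :=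
  ∃ n : ℕ, List.Sublist [a, b, c, d] (w.support.tail.rotate n)

/-- A `K4`-subdivision in `G`: four distinct branch vertices joined by six
internally disjoint paths (the arrises). -/
structure K4Sub (G : SimpleGraph V) where
  u1 : V
  u2 : V
  u3 : V
  u4 : V
  P1 : G.Walk u1 u2
  P2 : G.Walk u3 u4
  Q1 : G.Walk u2 u3
  Q2 : G.Walk u1 u4
  L1 : G.Walk u1 u3
  L2 : G.Walk u2 u4
  hu : List.Nodup [u1, u2, u3, u4]
  hP1 : P1.IsPath
  hP2 : P2.IsPath
  hQ1 : Q1.IsPath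
  hQ2 : Q2.IsPath
  hL1 : L1.IsPath
  hL2 : L2.IsPath
  hP : ∀ a ∈ P1.support, a ∉ P2.support
  hQ : ∀ a ∈ Q1.support, a ∉ Q2.support
  hL : ∀ a ∈ L1.support, a ∉ L2.support

namespace K4Sub

variable {G : SimpleGraph V}

/-- The face cycle `C1 = P1 ∪ Q1 ∪ L1`. -/
def C1 (H : K4Sub G) : G.Walk H.u1 H.u1 := (H.P1.append H.Q1).append H.L1.reverse
/-- The face cycle `C2 = P1 ∪ Q2 ∪ L2`. -/
def C2 (H : K4Sub G) : G.Walk H.u1 H.u1 := (H.P1.append H.L2).append H.Q2.reverse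
/-- The face cycle `C3 = P2 ∪ Q1 ∪ L2`. -/
def C3 (H : K4Sub G) : G.Walk H.u2 H.u2 := (H.Q1.append H.P2).append H.L2.reverse
/-- The face cycle `C4 = C1 △ C2 △ C3 = P2 ∪ Q2 ∪ L1`. -/
def C4 (H : K4Sub G) : G.Walk H.u1 H.u1 := (H.L1.append H.P2).append H.Q2.reverse

/-- The vertex set of the subdivision. -/
def verts (H : K4Sub G) : Set V :=
  {a | a ∈ H.P1.support ∨ a ∈ H.P2.support ∨ a ∈ H.Q1.support ∨
       a ∈ H.Q2.support ∨ a ∈ H.L1.support ∨ a ∈ H.L2.support}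

/-- The edge set of the subdivision. -/
def edges (H : K4Sub G) : Set (Sym2 V) :=
  {e | e ∈ H.P1.edges ∨ e ∈ H.P2.edges ∨ e ∈ H.Q1.edges ∨
       e ∈ H.Q2.edges ∨ e ∈ H.L1.edges ∨ e ∈ H.L2.edges}

end K4Sub

/-- `H` is an odd `K4`-subdivision: all four face cycles are odd holes. -/
def IsOddK4 (G : SimpleGraph V) (H : K4Sub G) : Prop :=
  IsOddHole G H.C1 ∧ IsOddHole G H.C2 ∧ IsOddHole G H.C3 ∧ IsOddHole G H.C4

/-- `G` has an odd `K4`-subdivision. -/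
def HasOddK4 (G : SimpleGraph V) : Prop := ∃ H : K4Sub G, IsOddK4 G H

/-- `H` is a balanced `K4`-subdivision of type `(1,2)`. -/
def IsBalancedK4 (G : SimpleGraph V) (H : K4Sub G) : Prop :=
  IsOddHole G H.C1 ∧ IsOddHole G H.C2 ∧
    IsHole G H.C3 ∧ Even H.C3.length ∧ IsHole G H.C4 ∧ Even H.C4.length ∧
    H.Q1.length = 1 ∧ 2 ≤ H.L2.length

/-- `G` contains a balanced `K4`-subdivision of type `(1,2)`. -/
def HasBalancedK4 (G : SimpleGraph V) : Prop := ∃ H : K4Sub G, IsBalancedK4 G H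

/-- `P` is a direct connection linking the (vertex sets of) two disjoint induced
subgraphs `S1` and `S2`. -/
def IsDirectConnection (G : SimpleGraph V) (S1 S2 : Set V) {v1 v2 : V}
    (P : G.Walk v1 v2) : Prop :=
  IsInducedPath G P ∧ (∀ x ∈ P.support, x ∉ S1 ∧ x ∉ S2) ∧
    (∃ y ∈ S1, G.Adj v1 y) ∧ (∃ y ∈ S2, G.Adj v2 y) ∧
    (∀ x ∈ P.support, (∃ y ∈ S1, G.Adj x y) → x = v1) ∧
    (∀ x ∈ P.support, (∃ y ∈ S2, G.Adj x y) → x = v2)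

/-- `P` is a minimal direct connection linking `S1` and `S2`. -/
def IsMinimalDirectConnection (G : SimpleGraph V) (S1 S2 : Set V) {v1 v2 : V}
    (P : G.Walk v1 v2) : Prop :=
  IsDirectConnection G S1 S2 P ∧
    ∀ (w1 w2 : V) (P' : G.Walk w1 w2), IsDirectConnection G S1 S2 P' →
      (∀ x ∈ P'.support, x ∈ P.support) → ∀ x ∈ P.support, x ∈ P'.support

section Walks

variable {G : SimpleGraph V}

lemma SimpleGraph.Walk.IsPath.append_of_meet {x y z : V} {p : G.Walk x y} {q : G.Walk y z}
    (hp : p.IsPath) (hq : q.IsPath) (h : ∀ a ∈ p.support, a ∈ q.support → a = y) :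
    (p.append q).IsPath := by
  rw [Walk.isPath_def, Walk.support_append, List.nodup_append']
  refine ⟨hp.support_nodup, hq.support_nodup.tail, fun a ha hb => ?_⟩
  have hn := hq.support_nodup
  rw [← Walk.cons_tail_support] at hn
  have := h a ha (List.mem_of_mem_tail hb)
  subst this
  exact (List.nodup_cons.mp hn).1 hb

/-- Two paths with the same ends that meet only at these ends form a cycle. -/
lemma SimpleGraph.Walk.IsPath.isCycle_append_reverse {x y : V} {p q : G.Walk x y}
    (hp : p.IsPath) (hq : q.IsPath) (h : ∀ a ∈ p.support, a ∈ q.support → a = x ∨ a = y)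
    (hn : 1 < p.length ∨ 1 < q.length) :
    (p.append q.reverse).IsCycle := by
  refine hp.isCycle_append hq.reverse (fun a ha hb => ?_) (by simpa using hn)
  have hpn := hp.support_nodup
  rw [← Walk.cons_tail_support] at hpn
  have hqn := hq.reverse.support_nodup
  rw [← Walk.cons_tail_support] at hqn
  have hbq : a ∈ q.support := by simpa using List.mem_of_mem_tail hb
  rcases h a (List.mem_of_mem_tail ha) hbq with rfl | rfl
  · exact (List.nodup_cons.mp hpn).1 ha
  · exact (List.nodup_cons.mp hqn).1 hb

/-- A walk through the vertices of a list splits at the first of them. -/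
lemma SimpleGraph.Walk.exists_append_of_sublist {x y a : V} {t : List V} (p : G.Walk x y)
    (h : List.Sublist (a :: t) p.support.tail) :
    ∃ (A : G.Walk x a) (R : G.Walk a y), p = A.append R ∧ List.Sublist t R.support.tail := by
  induction p with
  | nil => simp at h
  | cons e p ih =>
    rw [Walk.support_cons, List.tail_cons, ← Walk.cons_tail_support] at h
    cases h with
    | cons _ h =>
      obtain ⟨A, R, rfl, hR⟩ := ih h
      exact ⟨.cons e A, R, rfl, hR⟩
    | cons_cons _ h => exact ⟨.cons e .nil, p, rfl, h⟩

/-- A closed walk can be rotated so that its list of vertices is rotated by `n`. -/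
lemma SimpleGraph.Walk.exists_rotate {v : V} (w : G.Walk v v) (n : ℕ) (hw : ¬ w.Nil) :
    ∃ (z : V) (c : G.Walk z z), ¬ c.Nil ∧ c.support.tail = w.support.tail.rotate n ∧
      (∀ e, e ∈ c.edges ↔ e ∈ w.edges) ∧ c.length = w.length := by
  induction n with
  | zero => exact ⟨v, w, hw, by simp⟩
  | succ n ih =>
    obtain ⟨z, c, hc, h1, h2, h3⟩ := ih
    cases c with
    | nil => simp at hc
    | @cons _ y _ e p =>
      refine ⟨y, p.concat e, by simp [Walk.concat], ?_, ?_, by simpa using h3⟩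
      · rw [← List.rotate_rotate, ← h1, Walk.support_concat, Walk.support_cons, List.tail_cons]
        rw [(Walk.cons_tail_support p).symm]
        simp only [List.cons_append, List.tail_cons, List.rotate_cons_succ, List.rotate_zero]
      · intro e'
        rw [← h2]
        simp [Walk.edges_concat, or_comm]

lemma SimpleGraph.Walk.mem_support_iff_mem_tail {v a : V} {w : G.Walk v v} (hw : ¬ w.Nil) :
    a ∈ w.support ↔ a ∈ w.support.tail := by
  constructor
  · intro h
    rw [Walk.mem_support_iff] at h
    rcases h with rfl | h
    · exact w.end_mem_tail_support hw
    · exact h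
  · exact List.mem_of_mem_tail

/-- The first vertex of a walk with a given property. -/
lemma SimpleGraph.Walk.exists_first {s t : V} (P : G.Walk s t) (R : V → Prop)
    (h : ∃ x ∈ P.support, R x) :
    ∃ (x : V) (T : G.Walk s x) (T' : G.Walk x t), P = T.append T' ∧ R x ∧
      ∀ y ∈ T.support, y ≠ x → ¬ R y := by
  induction P with
  | nil =>
    obtain ⟨x, hx, hR⟩ := h
    rw [Walk.mem_support_nil_iff] at hx
    subst hx
    exact ⟨_, .nil, .nil, rfl, hR, by simp⟩
  | @cons a b c e p ih =>
    by_cases ha : R a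
    · exact ⟨a, .nil, .cons e p, rfl, ha, by simp⟩
    · obtain ⟨x, T, T', rfl, hx, hT⟩ := ih (by
        obtain ⟨x, hx, hR⟩ := h
        rw [Walk.support_cons, List.mem_cons] at hx
        rcases hx with rfl | hx
        · exact absurd hR ha
        · exact ⟨x, hx, hR⟩)
      refine ⟨x, .cons e T, T', rfl, hx, fun y hy hyx => ?_⟩
      rw [Walk.support_cons, List.mem_cons] at hy
      rcases hy with rfl | hy
      · exact ha
      · exact hT y hy hyx

lemma SimpleGraph.Walk.IsPath.exists_shorter_subpath {x y a b : V} {p : G.Walk x y}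
    (hp : p.IsPath) (ha : a ∈ p.support) (hb : b ∈ p.support) (hax : a ≠ x) (hay : a ≠ y) :
    ∃ S : G.Walk a b, S.IsPath ∧ S.length < p.length ∧ ∀ c ∈ S.support, c ∈ p.support := by
  classical
  have hs := p.take_spec ha
  have hlen : (p.takeUntil a ha).length + (p.dropUntil a ha).length = p.length := by
    rw [← Walk.length_append, hs]
  have h1 := Walk.length_takeUntil_lt_length ha hay
  have h2 := Walk.length_dropUntil_lt_length ha hax
  rw [← hs, Walk.mem_support_append_iff] at hb
  rcases hb with hb | hb
  · refine ⟨((p.takeUntil a ha).dropUntil b hb).reverse,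
      ((hp.takeUntil ha).dropUntil hb).reverse, ?_, fun c hc => ?_⟩
    · have := (p.takeUntil a ha).length_dropUntil_le_length hb
      rw [Walk.length_reverse]; omega
    · rw [Walk.support_reverse, List.mem_reverse] at hc
      exact p.support_takeUntil_subset_support ha
        ((p.takeUntil a ha).support_dropUntil_subset_support hb hc)
  · refine ⟨(p.dropUntil a ha).takeUntil b hb, (hp.dropUntil ha).takeUntil hb, ?_, fun c hc => ?_⟩
    · have := (p.dropUntil a ha).length_takeUntil_le_length hb
      omega
    · exact p.support_dropUntil_subset_support ha
        ((p.dropUntil a ha).support_takeUntil_subset_support hb hc)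

end Walks

section HoleLengths

variable {G : SimpleGraph V} {l : ℕ}

lemma MemGFam.le_length (hG : MemGFam G l) {v : V} {w : G.Walk v v} (hw : w.IsCycle) :
    2 * l + 1 ≤ w.length := by
  have h := hw.girth_le_length
  rwa [hG.1] at h

lemma MemGFam.length_eq (hG : MemGFam G l) {v : V} {w : G.Walk v v} (hw : IsHole G w)
    (ho : Odd w.length) : w.length = 2 * l + 1 := by
  have h1 := hG.le_length hw.1
  have h2 := hG.2 v w ⟨hw, ho⟩
  rw [Nat.odd_iff] at ho
  omega

end HoleLengths

namespace K4Sub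

variable {G : SimpleGraph V}

/-- Two arrises of `H` meet at most in a common end, and `H` is an induced subgraph of `G`. -/
structure IsInduced (H : K4Sub G) : Prop where
  p1q1 : ∀ a ∈ H.P1.support, a ∈ H.Q1.support → a = H.u2
  p1l1 : ∀ a ∈ H.P1.support, a ∈ H.L1.support → a = H.u1
  q1l1 : ∀ a ∈ H.Q1.support, a ∈ H.L1.support → a = H.u3
  p1q2 : ∀ a ∈ H.P1.support, a ∈ H.Q2.support → a = H.u1
  p1l2 : ∀ a ∈ H.P1.support, a ∈ H.L2.support → a = H.u2
  q2l2 : ∀ a ∈ H.Q2.support, a ∈ H.L2.support → a = H.u4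
  p2q1 : ∀ a ∈ H.P2.support, a ∈ H.Q1.support → a = H.u3
  p2l2 : ∀ a ∈ H.P2.support, a ∈ H.L2.support → a = H.u4
  q1l2 : ∀ a ∈ H.Q1.support, a ∈ H.L2.support → a = H.u2
  p2q2 : ∀ a ∈ H.P2.support, a ∈ H.Q2.support → a = H.u4
  p2l1 : ∀ a ∈ H.P2.support, a ∈ H.L1.support → a = H.u3
  q2l1 : ∀ a ∈ H.Q2.support, a ∈ H.L1.support → a = H.u1
  adj : ∀ a ∈ H.verts, ∀ b ∈ H.verts, G.Adj a b → s(a, b) ∈ H.edges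

/-- The same subdivision with its first two branch vertices exchanged. -/
def swap12 (H : K4Sub G) : K4Sub G where
  u1 := H.u2
  u2 := H.u1
  u3 := H.u3
  u4 := H.u4
  P1 := H.P1.reverse
  P2 := H.P2
  Q1 := H.L1
  Q2 := H.L2
  L1 := H.Q1
  L2 := H.Q2
  hu := by have := H.hu; grind
  hP1 := H.hP1.reverse
  hP2 := H.hP2
  hQ1 := H.hL1
  hQ2 := H.hL2
  hL1 := H.hQ1
  hL2 := H.hQ2
  hP := by simpa using H.hP
  hQ := H.hL
  hL := H.hQ

/-- The same subdivision with its last two branch vertices exchanged. -/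
def swap34 (H : K4Sub G) : K4Sub G where
  u1 := H.u1
  u2 := H.u2
  u3 := H.u4
  u4 := H.u3
  P1 := H.P1
  P2 := H.P2.reverse
  Q1 := H.L2
  Q2 := H.L1
  L1 := H.Q2
  L2 := H.Q1
  hu := by have := H.hu; grind
  hP1 := H.hP1
  hP2 := H.hP2.reverse
  hQ1 := H.hL2
  hQ2 := H.hL1
  hL1 := H.hQ2
  hL2 := H.hQ1
  hP := by simpa using H.hP
  hQ := fun a ha hb => H.hL a hb ha
  hL := fun a ha hb => H.hQ a hb ha

/-- The same subdivision with its two middle branch vertices exchanged. -/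
def swap23 (H : K4Sub G) : K4Sub G where
  u1 := H.u1
  u2 := H.u3
  u3 := H.u2
  u4 := H.u4
  P1 := H.L1
  P2 := H.L2
  Q1 := H.Q1.reverse
  Q2 := H.Q2
  L1 := H.P1
  L2 := H.P2
  hu := by have := H.hu; grind
  hP1 := H.hL1
  hP2 := H.hL2
  hQ1 := H.hQ1.reverse
  hQ2 := H.hQ2
  hL1 := H.hP1
  hL2 := H.hP2
  hP := H.hL
  hQ := by simpa using H.hQ
  hL := H.hP

lemma IsInduced.swap12 {H : K4Sub G} (h : H.IsInduced) : H.swap12.IsInduced := by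
  obtain ⟨_, _, _, _, _, _, _, _, _, _, _, _, hadj⟩ := h
  constructor <;> simp only [K4Sub.swap12, Walk.support_reverse, List.mem_reverse, K4Sub.verts,
    K4Sub.edges, Set.mem_ofPred_eq, Walk.edges_reverse] at hadj ⊢
  all_goals grind

lemma IsInduced.swap34 {H : K4Sub G} (h : H.IsInduced) : H.swap34.IsInduced := by
  obtain ⟨_, _, _, _, _, _, _, _, _, _, _, _, hadj⟩ := h
  constructor <;> simp only [K4Sub.swap34, Walk.support_reverse, List.mem_reverse, K4Sub.verts,
    K4Sub.edges, Set.mem_ofPred_eq, Walk.edges_reverse] at hadj ⊢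
  all_goals grind

lemma IsInduced.swap23 {H : K4Sub G} (h : H.IsInduced) : H.swap23.IsInduced := by
  obtain ⟨_, _, _, _, _, _, _, _, _, _, _, _, hadj⟩ := h
  constructor <;> simp only [K4Sub.swap23, Walk.support_reverse, List.mem_reverse, K4Sub.verts,
    K4Sub.edges, Set.mem_ofPred_eq, Walk.edges_reverse] at hadj ⊢
  all_goals grind

lemma ne_branch (H : K4Sub G) : H.u1 ≠ H.u2 ∧ H.u1 ≠ H.u3 ∧ H.u1 ≠ H.u4 ∧ H.u2 ≠ H.u3 ∧
    H.u2 ≠ H.u4 ∧ H.u3 ≠ H.u4 := by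
  have := H.hu
  grind

lemma length_pos (H : K4Sub G) : 0 < H.P1.length ∧ 0 < H.P2.length ∧ 0 < H.Q1.length ∧
    0 < H.Q2.length ∧ 0 < H.L1.length ∧ 0 < H.L2.length := by
  obtain ⟨h12, h13, h14, h23, h24, h34⟩ := H.ne_branch
  have pos : ∀ {x y : V} (p : G.Walk x y), x ≠ y → 0 < p.length := fun p hp =>
    Nat.pos_of_ne_zero fun h0 => hp (Walk.eq_of_length_eq_zero h0)
  exact ⟨pos _ h12, pos _ h34, pos _ h23, pos _ h14, pos _ h13, pos _ h24⟩

lemma length_C1 (H : K4Sub G) : H.C1.length = H.P1.length + H.Q1.length + H.L1.length := by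
  simp [C1]

lemma length_C2 (H : K4Sub G) : H.C2.length = H.P1.length + H.L2.length + H.Q2.length := by
  simp [C2]

lemma length_C3 (H : K4Sub G) : H.C3.length = H.Q1.length + H.P2.length + H.L2.length := by
  simp [C3]

lemma length_C4 (H : K4Sub G) : H.C4.length = H.L1.length + H.P2.length + H.Q2.length := by
  simp [C4]

/-- The cycle of `H` that avoids the arrises `Q1` and `Q2`. -/
def Z (H : K4Sub G) : G.Walk H.u1 H.u1 :=
  (H.P1.append (H.L2.append H.P2.reverse)).append H.L1.reverse

lemma length_Z (H : K4Sub G) :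
    H.Z.length = H.P1.length + H.L2.length + H.P2.length + H.L1.length := by
  simp [Z]; omega

lemma IsInduced.isCycle_C1 {H : K4Sub G} (h : H.IsInduced) : H.C1.IsCycle := by
  have hpos := H.length_pos
  refine (H.hP1.append_of_meet H.hQ1 h.p1q1).isCycle_append_reverse H.hL1 (fun a ha hb => ?_) ?_
  · rw [Walk.mem_support_append_iff] at ha
    rcases ha with ha | ha
    · exact .inl (h.p1l1 a ha hb)
    · exact .inr (h.q1l1 a ha hb)
  · rw [Walk.length_append]
    omega

lemma IsInduced.isCycle_Z {H : K4Sub G} (h : H.IsInduced) : H.Z.IsCycle := by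
  have hpos := H.length_pos
  have hq : (H.L2.append H.P2.reverse).IsPath :=
    H.hL2.append_of_meet H.hP2.reverse fun a ha hb => h.p2l2 a (by simpa using hb) ha
  have hp : (H.P1.append (H.L2.append H.P2.reverse)).IsPath := by
    refine H.hP1.append_of_meet hq fun a ha hb => ?_
    rw [Walk.mem_support_append_iff, Walk.support_reverse, List.mem_reverse] at hb
    exact hb.elim (h.p1l2 a ha) (fun hb => absurd hb (H.hP a ha))
  refine hp.isCycle_append_reverse H.hL1 (fun a ha hb => ?_) ?_
  · simp only [Walk.mem_support_append_iff, Walk.support_reverse, List.mem_reverse] at ha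
    rcases ha with ha | ha | ha
    · exact .inl (h.p1l1 a ha hb)
    · exact absurd ha (H.hL a hb)
    · exact .inr (h.p2l1 a ha hb)
  · simp only [Walk.length_append]
    omega

variable {l : ℕ}

lemma IsInduced.isHole_C1 {H : K4Sub G} (h : H.IsInduced) (hG : MemGFam G l) (hl : 2 ≤ l) :
    IsHole G H.C1 := by
  have hlen := hG.le_length h.isCycle_C1
  refine ⟨h.isCycle_C1, by omega, fun a ha b hb hab => ?_⟩
  have hE := h.adj a (by simp [C1, verts] at ha ⊢; tauto) b (by simp [C1, verts] at hb ⊢; tauto) hab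
  have hne := hab.ne
  simp only [C1, Walk.mem_support_append_iff, Walk.support_reverse, List.mem_reverse] at ha hb
  simp only [C1, Walk.edges_append, Walk.edges_reverse, List.mem_append, List.mem_reverse]
  rcases hE with he | he | he | he | he | he
  · tauto
  · have h1 := H.P2.fst_mem_support_of_mem_edges he
    have h2 := H.P2.snd_mem_support_of_mem_edges he
    have := H.hP; have := h.p2q1; have := h.p2l1
    grind
  · tauto
  · have h1 := H.Q2.fst_mem_support_of_mem_edges he
    have h2 := H.Q2.snd_mem_support_of_mem_edges he
    have := H.hQ; have := h.p1q2; have := h.q2l1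
    grind
  · tauto
  · have h1 := H.L2.fst_mem_support_of_mem_edges he
    have h2 := H.L2.snd_mem_support_of_mem_edges he
    have := H.hL; have := h.p1l2; have := h.q1l2
    grind

lemma IsInduced.isHole_C2 {H : K4Sub G} (h : H.IsInduced) (hG : MemGFam G l) (hl : 2 ≤ l) :
    IsHole G H.C2 :=
  h.swap34.isHole_C1 hG hl

lemma IsInduced.isHole_C4 {H : K4Sub G} (h : H.IsInduced) (hG : MemGFam G l) (hl : 2 ≤ l) :
    IsHole G H.C4 :=
  h.swap23.isHole_C2 hG hl

lemma IsInduced.isHole_C3 {H : K4Sub G} (h : H.IsInduced) (hG : MemGFam G l) (hl : 2 ≤ l) :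
    IsHole G H.C3 :=
  h.swap12.isHole_C4 hG hl

lemma IsInduced.isHole_Z {H : K4Sub G} (h : H.IsInduced) (hG : MemGFam G l) (hl : 2 ≤ l)
    (hQ1 : H.Q1.length ≠ 1) (hQ2 : H.Q2.length ≠ 1) : IsHole G H.Z := by
  have hlen := hG.le_length h.isCycle_Z
  refine ⟨h.isCycle_Z, by omega, fun a ha b hb hab => ?_⟩
  have hE := h.adj a (by simp [Z, verts] at ha ⊢; tauto) b (by simp [Z, verts] at hb ⊢; tauto) hab
  have hne := hab.ne
  simp only [Z, Walk.mem_support_append_iff, Walk.support_reverse, List.mem_reverse] at ha hb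
  simp only [Z, Walk.edges_append, Walk.edges_reverse, List.mem_append, List.mem_reverse]
  have hQ1' : s(H.u2, H.u3) ∉ H.Q1.edges := fun he => hQ1 (H.hQ1.length_eq_one_of_mem_edges he)
  have hQ2' : s(H.u1, H.u4) ∉ H.Q2.edges := fun he => hQ2 (H.hQ2.length_eq_one_of_mem_edges he)
  rcases hE with he | he | he | he | he | he
  · tauto
  · tauto
  · have h1 := H.Q1.fst_mem_support_of_mem_edges he
    have h2 := H.Q1.snd_mem_support_of_mem_edges he
    have hmeet : ∀ x ∈ H.Q1.support, (x ∈ H.P1.support ∨ x ∈ H.L2.support ∨ x ∈ H.P2.support) ∨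
        x ∈ H.L1.support → x = H.u2 ∨ x = H.u3 := by
      rintro x hx ((hz | hz | hz) | hz)
      · exact .inl (h.p1q1 x hz hx)
      · exact .inl (h.q1l2 x hx hz)
      · exact .inr (h.p2q1 x hz hx)
      · exact .inr (h.q1l1 x hx hz)
    have ha' := hmeet a h1 ha
    have hb' := hmeet b h2 hb
    clear hmeet ha hb
    have := Sym2.eq_swap (a := H.u2) (b := H.u3)
    grind
  · have h1 := H.Q2.fst_mem_support_of_mem_edges he
    have h2 := H.Q2.snd_mem_support_of_mem_edges he
    have hmeet : ∀ x ∈ H.Q2.support, (x ∈ H.P1.support ∨ x ∈ H.L2.support ∨ x ∈ H.P2.support) ∨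
        x ∈ H.L1.support → x = H.u1 ∨ x = H.u4 := by
      rintro x hx ((hz | hz | hz) | hz)
      · exact .inl (h.p1q2 x hz hx)
      · exact .inr (h.q2l2 x hx hz)
      · exact .inr (h.p2q2 x hz hx)
      · exact .inl (h.q2l1 x hx hz)
    have ha' := hmeet a h1 ha
    have hb' := hmeet b h2 hb
    clear hmeet ha hb
    have := Sym2.eq_swap (a := H.u1) (b := H.u4)
    grind
  · tauto
  · tauto

lemma IsInduced.hasBalancedK4 {H : K4Sub G} (h : H.IsInduced) (hG : MemGFam G l) (hl : 2 ≤ l)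
    (h1 : Odd H.C1.length) (h2 : Odd H.C2.length) (h3 : Even H.C3.length)
    (hP2 : H.P2.length < 2 * l) : HasBalancedK4 G := by
  have of_one : ∀ H' : K4Sub G, H'.IsInduced → Odd H'.C1.length → Odd H'.C2.length →
      Even H'.C3.length → H'.P2.length < 2 * l → H'.Q1.length = 1 → HasBalancedK4 G := by
    intro H' h' h1 h2 h3 hP2 hQ1
    have hC3 := h'.isHole_C3 hG hl
    have hlen := hG.le_length hC3.1
    have h4 : Even H'.C4.length := by
      rw [length_C1, Nat.odd_iff] at h1
      rw [length_C2, Nat.odd_iff] at h2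
      rw [length_C3, Nat.even_iff] at h3
      rw [length_C4, Nat.even_iff]
      omega
    refine ⟨H', ⟨h'.isHole_C1 hG hl, h1⟩, ⟨h'.isHole_C2 hG hl, h2⟩, hC3, h3,
      h'.isHole_C4 hG hl, h4, hQ1, ?_⟩
    rw [length_C3] at hlen h3
    rw [Nat.even_iff] at h3
    omega
  have e1 := hG.length_eq (h.isHole_C1 hG hl) h1
  have e2 := hG.length_eq (h.isHole_C2 hG hl) h2
  have e3 := hG.le_length (h.isHole_C3 hG hl).1
  have e4 := hG.le_length (h.isHole_C4 hG hl).1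
  have z1 := h.isHole_Z hG hl
  have z2 := h.swap34.isHole_Z hG hl
  have y1 := fun a b => hG.length_eq (z1 a b)
  have y2 := fun a b => hG.length_eq (z2 a b)
  have f1 := of_one H h
  have f2 := of_one _ h.swap34
  have f3 := of_one _ h.swap12
  have f4 := of_one _ h.swap12.swap34
  simp only [length_C1, length_C2, length_C3, length_C4, length_Z, K4Sub.swap12, K4Sub.swap34,
    Walk.length_reverse, Nat.odd_iff, Nat.even_iff] at *
  by_contra hc
  simp only [hc, imp_false] at f1 f2 f3 f4
  omega

/-- An induced subdivision with an odd face `C1` and short arrises at the opposite vertex. -/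
lemma IsInduced.hasOddK4_or_hasBalancedK4 {H : K4Sub G} (h : H.IsInduced) (hG : MemGFam G l)
    (hl : 2 ≤ l) (h1 : Odd H.C1.length) (hP2 : H.P2.length < 2 * l) (hQ2 : H.Q2.length < 2 * l)
    (hL2 : H.L2.length < 2 * l) : HasOddK4 G ∨ HasBalancedK4 G := by
  have f1 := fun a b => h.hasBalancedK4 hG hl h1 a b hP2
  have f2 := h.swap23.hasBalancedK4 hG hl
  have f3 := h.swap12.swap23.hasBalancedK4 hG hl
  have f4 : Odd H.C2.length → Odd H.C3.length → Odd H.C4.length → HasOddK4 G := fun h2 h3 h4 =>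
    ⟨H, ⟨h.isHole_C1 hG hl, h1⟩, ⟨h.isHole_C2 hG hl, h2⟩, ⟨h.isHole_C3 hG hl, h3⟩,
      ⟨h.isHole_C4 hG hl, h4⟩⟩
  simp only [length_C1, length_C2, length_C3, length_C4, K4Sub.swap12, K4Sub.swap23,
    Walk.length_reverse, Nat.odd_iff, Nat.even_iff] at *
  by_contra! hc
  simp only [hc.1, hc.2, imp_false] at f1 f2 f3 f4
  omega

end K4Sub

section Arcs

variable {G : SimpleGraph V}

/-- `A`, `B`, `D`, `E` are paths into which four vertices of the closed walk `w` divide it. -/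
structure IsArcs4 {v a b c d : V} (w : G.Walk v v) (A : G.Walk a b) (B : G.Walk b c)
    (D : G.Walk c d) (E : G.Walk d a) : Prop where
  pathA : A.IsPath
  pathB : B.IsPath
  pathD : D.IsPath
  pathE : E.IsPath
  ab : ∀ x ∈ A.support, x ∈ B.support → x = b
  bd : ∀ x ∈ B.support, x ∈ D.support → x = c
  de : ∀ x ∈ D.support, x ∈ E.support → x = d
  ea : ∀ x ∈ E.support, x ∈ A.support → x = a
  ad : ∀ x ∈ A.support, x ∉ D.support
  be : ∀ x ∈ B.support, x ∉ E.support
  supp : ∀ x, x ∈ w.support ↔ x ∈ A.support ∨ x ∈ B.support ∨ x ∈ D.support ∨ x ∈ E.support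
  edge : ∀ e, e ∈ w.edges ↔ e ∈ A.edges ∨ e ∈ B.edges ∨ e ∈ D.edges ∨ e ∈ E.edges
  len : w.length = A.length + B.length + D.length + E.length

lemma IsArcs4.rotate {v a b c d : V} {w : G.Walk v v} {A : G.Walk a b} {B : G.Walk b c}
    {D : G.Walk c d} {E : G.Walk d a} (h : IsArcs4 w A B D E) : IsArcs4 w B D E A where
  pathA := h.pathB
  pathB := h.pathD
  pathD := h.pathE
  pathE := h.pathA
  ab := h.bd
  bd := h.de
  de := h.ea
  ea := h.ab
  ad := h.be
  be := fun x hx hx' => h.ad x hx' hx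
  supp := fun x => by rw [h.supp]; tauto
  edge := fun x => by rw [h.edge]; tauto
  len := by rw [h.len]; omega

lemma exists_isArcs4 {v a b c d : V} {w : G.Walk v v} (hw : w.IsCycle)
    (hn : List.Nodup [a, b, c, d]) (h : CyclicOrder4 G w a b c d) :
    ∃ (A : G.Walk a b) (B : G.Walk b c) (D : G.Walk c d) (E : G.Walk d a),
      IsArcs4 w A B D E := by
  obtain ⟨n, hs⟩ := h
  obtain ⟨z, c', hc, hct, hce, hcl⟩ := w.exists_rotate n hw.not_nil
  rw [← hct] at hs
  obtain ⟨A₀, R₁, rfl, hs₁⟩ := c'.exists_append_of_sublist hs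
  obtain ⟨A, R₂, rfl, hs₂⟩ := R₁.exists_append_of_sublist hs₁
  obtain ⟨B, R₃, rfl, hs₃⟩ := R₂.exists_append_of_sublist hs₂
  obtain ⟨D, E₀, rfl, -⟩ := R₃.exists_append_of_sublist hs₃
  clear hs hs₁ hs₂ hs₃
  obtain ⟨hab, hbc, hcd, hda⟩ : a ≠ b ∧ b ≠ c ∧ c ≠ d ∧ d ≠ a := by grind
  have mA := A.end_mem_tail_support (Walk.not_nil_of_ne hab)
  have mB := B.end_mem_tail_support (Walk.not_nil_of_ne hbc)
  have mD := D.end_mem_tail_support (Walk.not_nil_of_ne hcd)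
  have mE := (E₀.append A₀).end_mem_tail_support (Walk.not_nil_of_ne hda)
  have hnd : (w.support.tail.rotate n).Nodup := List.nodup_rotate.mpr hw.support_nodup
  rw [← hct] at hnd
  have hmem : ∀ x, x ∈ w.support ↔
      x ∈ (A₀.append (A.append (B.append (D.append E₀)))).support.tail := by
    intro x
    rw [hct, List.mem_rotate, ← Walk.mem_support_iff_mem_tail hw.not_nil]
  simp only [Walk.tail_support_append] at hnd hmem
  have hE : (E₀.append A₀).support.tail = E₀.support.tail ++ A₀.support.tail :=
    Walk.tail_support_append ..
  have hperm : (A₀.support.tail ++ (A.support.tail ++ (B.support.tail ++ (D.support.tail ++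
      E₀.support.tail)))).Perm ((E₀.append A₀).support.tail ++ (A.support.tail ++
      (B.support.tail ++ D.support.tail))) := by
    classical
    rw [hE]
    refine List.perm_iff_count.mpr fun x => ?_
    simp only [List.count_append]
    omega
  rw [hperm.nodup_iff] at hnd
  have hmem' : ∀ x, x ∈ w.support ↔ x ∈ (E₀.append A₀).support.tail ∨ x ∈ A.support.tail ∨
      x ∈ B.support.tail ∨ x ∈ D.support.tail := by
    intro x
    rw [hmem, hperm.mem_iff]
    simp only [List.mem_append]
  simp only [List.nodup_append', List.disjoint_append_right] at hnd
  obtain ⟨nE, ⟨nA, ⟨nB, nD, dBD⟩, dAB, dAD⟩, dEA, dEB, dED⟩ := hnd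
  have hedge : ∀ e, e ∈ (E₀.append A₀).edges ↔ e ∈ E₀.edges ∨ e ∈ A₀.edges := by simp
  have hlen : (E₀.append A₀).length = E₀.length + A₀.length := by simp
  simp only [Walk.edges_append, List.mem_append, Walk.length_append] at hce hcl
  generalize E₀.append A₀ = E at *
  refine ⟨A, B, D, E, ?_⟩
  have path_of : ∀ {x y : V} (p : G.Walk x y), x ∉ p.support.tail → p.support.tail.Nodup →
      p.IsPath := by
    intro x y p h1 h2
    rw [Walk.isPath_def, ← Walk.cons_tail_support, List.nodup_cons]
    exact ⟨h1, h2⟩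
  constructor
  · exact path_of A (fun h => dEA mE h) nA
  · exact path_of B (fun h => dAB mA h) nB
  · exact path_of D (fun h => dBD mB h) nD
  · exact path_of E (fun h => dED h mD) nE
  · intro x h1 h2
    rw [Walk.mem_support_iff] at h1 h2
    rcases h2 with h2 | h2
    · exact h2
    · rcases h1 with rfl | h1
      · exact absurd h2 (fun h => dEB mE h)
      · exact absurd h2 (fun h => dAB h1 h)
  · intro x h1 h2
    rw [Walk.mem_support_iff] at h1 h2
    rcases h2 with h2 | h2
    · exact h2
    · rcases h1 with rfl | h1
      · exact absurd h2 (fun h => dAD mA h)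
      · exact absurd h2 (fun h => dBD h1 h)
  · intro x h1 h2
    rw [Walk.mem_support_iff] at h1 h2
    rcases h2 with h2 | h2
    · exact h2
    · rcases h1 with rfl | h1
      · exact absurd h2 (fun h => dEB h mB)
      · exact absurd h2 (fun h => dED h h1)
  · intro x h1 h2
    rw [Walk.mem_support_iff] at h1 h2
    rcases h2 with h2 | h2
    · exact h2
    · rcases h1 with rfl | h1
      · exact absurd h2 (fun h => dAD h mD)
      · exact absurd h2 (fun h => dEA h1 h)
  · intro x h1 h2
    rw [Walk.mem_support_iff] at h1 h2
    rcases h1 with rfl | h1 <;> rcases h2 with rfl | h2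
    · exact dEB mE mB
    · exact dED mE h2
    · exact dAB h1 mB
    · exact dAD h1 h2
  · intro x h1 h2
    rw [Walk.mem_support_iff] at h1 h2
    rcases h1 with rfl | h1 <;> rcases h2 with rfl | h2
    · exact dAD mA mD
    · exact dEA h2 mA
    · exact dBD h1 mD
    · exact dEB h2 h1
  · intro x
    rw [hmem', Walk.mem_support_iff (p := A), Walk.mem_support_iff (p := B),
      Walk.mem_support_iff (p := D), Walk.mem_support_iff (p := E)]
    constructor
    · tauto
    · rintro ((rfl | h) | (rfl | h) | (rfl | h) | (rfl | h)) <;> tauto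
  · intro e
    rw [← hce, hedge]
    tauto
  · omega

end Arcs

section ShortJumps

variable {G : SimpleGraph V}

lemma wInterior_reverse {x y : V} (P : G.Walk x y) : wInterior P.reverse = wInterior P := by
  ext a
  simp only [wInterior, Set.mem_ofPred_eq, Walk.support_reverse, List.mem_reverse]
  tauto

lemma IsShortJump.reverse {v s t : V} {w : G.Walk v v} {P : G.Walk s t}
    (h : IsShortJump G w P) : IsShortJump G w P.reverse := by
  obtain ⟨⟨h1, h2, h3, h4, h5, ⟨h6, h7⟩, h8⟩, h9⟩ := h
  refine ⟨⟨h1, h3, h2, h4.symm, fun h => h5 h.symm, ⟨h6.reverse, ?_⟩, ?_⟩, ?_⟩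
  · simpa using h7
  · rwa [wInterior_reverse]
  · rw [wInterior_reverse]
    exact fun a ha hs ht => h9 a ha ht hs

lemma IsShortJump.eq_or_eq {v s t : V} {w : G.Walk v v} {P : G.Walk s t}
    (h : IsShortJump G w P) {x : V} (hx : x ∈ P.support) (hw : x ∈ w.support) : x = s ∨ x = t := by
  by_contra! hc
  exact h.1.2.2.2.2.2.2 x ⟨hx, hc⟩ hw

lemma IsShortJump.mem_edges {v s t : V} {w : G.Walk v v} {P : G.Walk s t}
    (h : IsShortJump G w P) {x y : V} (hx : x ∈ w.support) (hy : y ∈ P.support)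
    (hxy : G.Adj x y) : s(x, y) ∈ w.edges ∨ s(x, y) ∈ P.edges := by
  obtain ⟨⟨h1, h2, h3, h4, h5, ⟨h6, h7⟩, h8⟩, h9⟩ := h
  by_cases hyi : y ∈ wInterior P
  · by_cases hxs : x = s
    · subst hxs
      exact .inr (h7 _ P.start_mem_support _ hy hxy)
    · by_cases hxt : x = t
      · subst hxt
        exact .inr (h7 _ P.end_mem_support _ hy hxy)
      · exact absurd hxy (h9 x hx hxs hxt y hyi)
  · refine .inl (h1.2.2 x hx y ?_ hxy)
    by_cases hys : y = s
    · rwa [hys]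
    · by_cases hyt : y = t
      · rwa [hyt]
      · exact absurd ⟨hy, hys, hyt⟩ hyi

variable {l : ℕ} {v a b c d : V} {w : G.Walk v v} {A : G.Walk a b} {B : G.Walk b c}
  {D : G.Walk c d} {E : G.Walk d a}

lemma IsArcs4.isHole_append_reverse (h : IsArcs4 w A B D E) (hG : MemGFam G l) (hl : 2 ≤ l)
    (hn : List.Nodup [a, b, c, d]) {P : G.Walk a c} (hP : IsShortJump G w P) :
    IsHole G ((A.append B).append P.reverse) := by
  have hX : (A.append B).IsPath := h.pathA.append_of_meet h.pathB h.ab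
  have hcyc : ((A.append B).append P.reverse).IsCycle := by
    refine hX.isCycle_append_reverse hP.1.2.2.2.2.2.1.1 (fun x hx hx' => ?_) ?_
    · refine hP.eq_or_eq hx' ((h.supp x).mpr ?_)
      rw [Walk.mem_support_append_iff] at hx
      tauto
    · left
      have hA : A.length ≠ 0 := fun h0 => by
        have := Walk.eq_of_length_eq_zero h0; grind
      have hB : B.length ≠ 0 := fun h0 => by
        have := Walk.eq_of_length_eq_zero h0; grind
      rw [Walk.length_append]
      omega
  have hlen := hG.le_length hcyc
  refine ⟨hcyc, by omega, ?_⟩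
  simp only [Walk.mem_support_append_iff, Walk.support_reverse, List.mem_reverse,
    Walk.edges_append, Walk.edges_reverse, List.mem_append]
  have hww : ∀ x, x ∈ A.support ∨ x ∈ B.support → ∀ y, y ∈ A.support ∨ y ∈ B.support →
      s(x, y) ∈ w.edges → s(x, y) ∈ A.edges ∨ s(x, y) ∈ B.edges := by
    intro x hx y hy he
    have hne := (w.adj_of_mem_edges he).ne
    have := h.ab; have := h.bd; have := h.de; have := h.ea; have := h.ad; have := h.be
    rcases (h.edge _).mp he with he | he | he | he
    · exact .inl he
    · exact .inr he
    · have := D.fst_mem_support_of_mem_edges he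
      have := D.snd_mem_support_of_mem_edges he
      grind
    · have := E.fst_mem_support_of_mem_edges he
      have := E.snd_mem_support_of_mem_edges he
      grind
  have hwP : ∀ x, x ∈ A.support ∨ x ∈ B.support → ∀ y ∈ P.support, G.Adj x y →
      (s(x, y) ∈ A.edges ∨ s(x, y) ∈ B.edges) ∨ s(x, y) ∈ P.edges := by
    intro x hx y hy hxy
    have hxw : x ∈ w.support := (h.supp x).mpr (by tauto)
    rcases hP.mem_edges hxw hy hxy with he | he
    · refine .inl (hww x hx y ?_ he)
      rcases hP.eq_or_eq hy (w.snd_mem_support_of_mem_edges he) with rfl | rfl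
      · exact .inl A.start_mem_support
      · exact .inr B.end_mem_support
    · exact .inr he
  rintro x (hx | hx) y (hy | hy) hxy
  · exact .inl (hww x hx y hy (hP.1.1.2.2 x ((h.supp x).mpr (by tauto)) y
      ((h.supp y).mpr (by tauto)) hxy))
  · exact hwP x hx y hy hxy
  · rw [Sym2.eq_swap]
    exact hwP y hy x hx hxy.symm
  · exact .inr (hP.1.2.2.2.2.2.1.2 x hx y hy hxy)

/-- A short jump over an odd hole of a graph in `𝒢ₗ` has at least three
and fewer than `2l` edges. -/
lemma IsArcs4.length_jump (h : IsArcs4 w A B D E) (hG : MemGFam G l) (hl : 2 ≤ l)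
    (hw : IsOddHole G w) (hn : List.Nodup [a, b, c, d]) {P : G.Walk a c}
    (hP : IsShortJump G w P) : 3 ≤ P.length ∧ P.length < 2 * l := by
  have h1 := h.isHole_append_reverse hG hl hn hP
  have h2 := h.rotate.rotate.isHole_append_reverse hG hl (by grind) hP.reverse
  have e1 := hG.le_length h1.1
  have e2 := hG.le_length h2.1
  have o1 := hG.length_eq h1
  have o2 := hG.length_eq h2
  have o := hG.length_eq hw.1 hw.2
  have pos : ∀ {x y : V} (p : G.Walk x y), x ≠ y → 0 < p.length := fun p hp =>
    Nat.pos_of_ne_zero fun h0 => hp (Walk.eq_of_length_eq_zero h0)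
  have pA := pos A (by grind)
  have pB := pos B (by grind)
  have pD := pos D (by grind)
  have pE := pos E (by grind)
  have hlen := h.len
  simp only [Walk.length_append, Walk.length_reverse, Nat.odd_iff] at *
  omega

end ShortJumps

section Crossing

variable {G : SimpleGraph V} {l : ℕ} {v a b c d : V} {w : G.Walk v v} {A : G.Walk a b}
  {B : G.Walk b c} {D : G.Walk c d} {E : G.Walk d a}

lemma SimpleGraph.Walk.IsPath.eq_of_mem_append {x y z u : V} {p : G.Walk x y} {q : G.Walk y z}
    (h : (p.append q).IsPath) (hp : u ∈ p.support) (hq : u ∈ q.support) : u = y := by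
  rw [Walk.mem_support_iff] at hq
  refine hq.resolve_right fun hq => ?_
  have hn := h.support_nodup
  rw [Walk.support_append, List.nodup_append'] at hn
  exact hn.2.2 hp hq

lemma SimpleGraph.Walk.IsPath.exists_adj_pred {s t y : V} {T : G.Walk s t} (hT : T.IsPath)
    (hy : y ∈ T.support) (hys : y ≠ s) : ∃ z ∈ T.support, z ≠ t ∧ G.Adj z y := by
  obtain ⟨q, r, hq, hr, rfl⟩ := hT.mem_support_iff_exists_append.mp hy
  have hadj : G.Adj q.penultimate y := q.adj_penultimate (Walk.not_nil_of_ne hys.symm)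
  have hmem : q.penultimate ∈ q.support := q.getVert_mem_support _
  exact ⟨q.penultimate, (Walk.mem_support_append_iff _ _).mpr (.inl hmem), fun h =>
    hadj.ne (hT.eq_of_mem_append hmem (h ▸ r.end_mem_support)), hadj⟩

/-- A vertex outside a path of length less than `2l` has at most one neighbour in its interior. -/
lemma MemGFam.eq_of_adj_interior (hG : MemGFam G l) {s t x y z : V} {P : G.Walk s t}
    (hP : P.IsPath) (hlen : P.length < 2 * l) (hx : x ∉ P.support) (hy : y ∈ wInterior P)
    (hz : z ∈ wInterior P) (hxy : G.Adj x y) (hxz : G.Adj x z) : y = z := by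
  by_contra hyz
  obtain ⟨S, hS, hSl, hSs⟩ := hP.exists_shorter_subpath hy.1 hz.1 hy.2.1 hy.2.2
  have hxS : x ∉ S.support := fun h => hx (hSs x h)
  have hpath : (Walk.cons hxy S).IsPath := (Walk.cons_isPath_iff hxy S).mpr ⟨hS, hxS⟩
  have hpos : 0 < S.length := Nat.pos_of_ne_zero fun h0 => hyz (Walk.eq_of_length_eq_zero h0)
  have hone : (Walk.cons hxz Walk.nil).IsPath := by
    simp [Walk.cons_isPath_iff, hxz.ne]
  have hcyc := hpath.isCycle_append_reverse hone (by simp) (.inl (by simp; omega))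
  have := hG.le_length hcyc
  simp only [Walk.length_append, Walk.length_reverse, Walk.length_cons, Walk.length_nil] at this
  omega

lemma IsShortJump.mem_wInterior {s t x : V} {P : G.Walk s t} (h : IsShortJump G w P)
    (hx : x ∈ P.support) (hw : x ∉ w.support) : x ∈ wInterior P :=
  ⟨hx, fun hs => hw (hs ▸ h.1.2.1), fun ht => hw (ht ▸ h.1.2.2.1)⟩

lemma IsShortJump.disjoint_of_not_adj {a b c d : V} {P₁ : G.Walk a c} {P₂ : G.Walk b d}
    (h₁ : IsShortJump G w P₁) (h₂ : IsShortJump G w P₂) (hn : List.Nodup [a, b, c, d])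
    (hno : ∀ y ∈ wInterior P₁, ∀ z ∈ wInterior P₂, ¬ G.Adj y z) :
    ∀ x ∈ P₁.support, x ∉ P₂.support := by
  obtain ⟨hab, had, hcb, hcd⟩ : a ≠ b ∧ a ≠ d ∧ c ≠ b ∧ c ≠ d := by grind
  intro x hx hx'
  have hxw : x ∉ w.support := fun hxw => by
    rcases h₁.eq_or_eq hx hxw with rfl | rfl <;> rcases h₂.eq_or_eq hx' hxw with h | h <;> grind
  have hxa : x ≠ a := fun h => hxw (h ▸ h₁.1.2.1)
  have hx2 := h₂.mem_wInterior hx' hxw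
  obtain ⟨y, hy, hyc, hyx⟩ := h₁.1.2.2.2.2.2.1.1.exists_adj_pred hx hxa
  by_cases hya : y = a
  · subst hya
    exact h₂.2 y h₁.1.2.1 hab had x hx2 hyx
  · exact hno y ⟨hy, hya, hyc⟩ x hx2 hyx

/-- Two crossing short jumps without edges between their interiors, the first of which closes
an odd cycle with `A` and `B`. -/
lemma IsArcs4.hasK4_of_not_adj (h : IsArcs4 w A B D E) (hG : MemGFam G l) (hl : 2 ≤ l)
    (hw : IsOddHole G w) (hn : List.Nodup [a, b, c, d]) {P₁ : G.Walk a c} {P₂ : G.Walk b d}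
    (h₁ : IsShortJump G w P₁) (h₂ : IsShortJump G w P₂)
    (hno : ∀ y ∈ wInterior P₁, ∀ z ∈ wInterior P₂, ¬ G.Adj y z)
    (hodd : Odd (A.length + B.length + P₁.length)) : HasOddK4 G ∨ HasBalancedK4 G := by
  have hdisj := h₁.disjoint_of_not_adj h₂ hn hno
  obtain ⟨-, hl₂⟩ := h.rotate.length_jump hG hl hw (by grind) h₂
  have e₁ := fun x hx => h₁.eq_or_eq (x := x) hx
  have e₂ := fun x hx => h₂.eq_or_eq (x := x) hx
  have pos : ∀ {x y : V} (p : G.Walk x y), x ≠ y → 0 < p.length := fun p hp =>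
    Nat.pos_of_ne_zero fun h0 => hp (Walk.eq_of_length_eq_zero h0)
  have pA := pos A (by grind)
  have pB := pos B (by grind)
  have hlen := h.len
  have hwl := hG.length_eq hw.1 hw.2
  let H : K4Sub G :=
    { u1 := a, u2 := b, u3 := c, u4 := d
      P1 := A, P2 := D, Q1 := B, Q2 := E.reverse, L1 := P₁, L2 := P₂
      hu := hn
      hP1 := h.pathA, hP2 := h.pathD, hQ1 := h.pathB, hQ2 := h.pathE.reverse
      hL1 := h₁.1.2.2.2.2.2.1.1, hL2 := h₂.1.2.2.2.2.2.1.1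
      hP := h.ad
      hQ := by simpa using h.be
      hL := hdisj }
  have hE : ∀ e ∈ w.edges, e ∈ H.edges := by
    intro e he
    simp only [H, K4Sub.edges, Set.mem_ofPred_eq, Walk.edges_reverse, List.mem_reverse]
    rcases (h.edge e).mp he with he | he | he | he <;> simp only [he, true_or, or_true]
  have hE₁ : ∀ e ∈ P₁.edges, e ∈ H.edges := fun e he =>
    .inr (.inr (.inr (.inr (.inl he))))
  have hE₂ : ∀ e ∈ P₂.edges, e ∈ H.edges := fun e he =>
    .inr (.inr (.inr (.inr (.inr he))))
  have hverts : ∀ x ∈ H.verts, x ∈ w.support ∨ x ∈ P₁.support ∨ x ∈ P₂.support := by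
    intro x hx
    simp only [H, K4Sub.verts, Set.mem_ofPred_eq, Walk.support_reverse, List.mem_reverse] at hx
    rw [h.supp]
    rcases hx with hx | hx | hx | hx | hx | hx <;> simp only [hx, true_or, or_true]
  have hadj : ∀ x ∈ H.verts, ∀ y ∈ H.verts, G.Adj x y → s(x, y) ∈ H.edges := by
    have hwP₁ : ∀ x ∈ w.support, ∀ y ∈ P₁.support, G.Adj x y → s(x, y) ∈ H.edges :=
      fun x hx y hy hxy => (h₁.mem_edges hx hy hxy).elim (hE _) (hE₁ _)
    have hwP₂ : ∀ x ∈ w.support, ∀ y ∈ P₂.support, G.Adj x y → s(x, y) ∈ H.edges :=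
      fun x hx y hy hxy => (h₂.mem_edges hx hy hxy).elim (hE _) (hE₂ _)
    have hPP : ∀ x ∈ P₁.support, ∀ y ∈ P₂.support, G.Adj x y → s(x, y) ∈ H.edges := by
      intro x hx y hy hxy
      by_cases hxw : x ∈ w.support
      · exact hwP₂ x hxw y hy hxy
      by_cases hyw : y ∈ w.support
      · rw [Sym2.eq_swap]
        exact hwP₁ y hyw x hx hxy.symm
      exact absurd hxy (hno x (h₁.mem_wInterior hx hxw) y (h₂.mem_wInterior hy hyw))
    intro x hx y hy hxy
    rcases hverts x hx with hx | hx | hx <;> rcases hverts y hy with hy | hy | hy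
    · exact hE _ (hw.1.2.2 x hx y hy hxy)
    · exact hwP₁ x hx y hy hxy
    · exact hwP₂ x hx y hy hxy
    · rw [Sym2.eq_swap]
      exact hwP₁ y hy x hx hxy.symm
    · exact hE₁ _ (h₁.1.2.2.2.2.2.1.2 x hx y hy hxy)
    · exact hPP x hx y hy hxy
    · rw [Sym2.eq_swap]
      exact hwP₂ y hy x hx hxy.symm
    · rw [Sym2.eq_swap]
      exact hPP y hy x hx hxy.symm
    · exact hE₂ _ (h₂.1.2.2.2.2.2.1.2 x hx y hy hxy)
  have hAw : ∀ x ∈ A.support, x ∈ w.support := fun x hx => (h.supp x).mpr (.inl hx)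
  have hBw : ∀ x ∈ B.support, x ∈ w.support := fun x hx => (h.supp x).mpr (.inr (.inl hx))
  have hDw : ∀ x ∈ D.support, x ∈ w.support := fun x hx => (h.supp x).mpr (.inr (.inr (.inl hx)))
  have hEw : ∀ x ∈ E.support, x ∈ w.support := fun x hx => (h.supp x).mpr (.inr (.inr (.inr hx)))
  have hmE : ∀ x ∈ H.Q2.support, x ∈ E.support := fun x hx => by simpa [H] using hx
  have hH : H.IsInduced :=
    { p1q1 := h.ab
      p1l1 := fun x hx hx' => (e₁ x hx' (hAw x hx)).resolve_right fun r =>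
        h.ad x hx (r ▸ D.start_mem_support)
      q1l1 := fun x hx hx' => (e₁ x hx' (hBw x hx)).resolve_left fun r =>
        h.be x hx (r ▸ E.end_mem_support)
      p1q2 := fun x hx hx' => h.ea x (hmE x hx') hx
      p1l2 := fun x hx hx' => (e₂ x hx' (hAw x hx)).resolve_right fun r =>
        h.ad x hx (r ▸ D.end_mem_support)
      q2l2 := fun x hx hx' => (e₂ x hx' (hEw x (hmE x hx))).resolve_left fun r =>
        h.be x (r ▸ B.start_mem_support) (hmE x hx)
      p2q1 := fun x hx hx' => h.bd x hx' hx
      p2l2 := fun x hx hx' => (e₂ x hx' (hDw x hx)).resolve_left fun r =>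
        h.ad x (r ▸ A.end_mem_support) hx
      q1l2 := fun x hx hx' => (e₂ x hx' (hBw x hx)).resolve_right fun r =>
        h.be x hx (r ▸ E.start_mem_support)
      p2q2 := fun x hx hx' => h.de x hx (hmE x hx')
      p2l1 := fun x hx hx' => (e₁ x hx' (hDw x hx)).resolve_left fun r =>
        h.ad x (r ▸ A.start_mem_support) hx
      q2l1 := fun x hx hx' => (e₁ x hx' (hEw x (hmE x hx))).resolve_right fun r =>
        h.be x (r ▸ B.end_mem_support) (hmE x hx)
      adj := hadj }
  refine hH.hasOddK4_or_hasBalancedK4 hG hl ?_ ?_ ?_ ?_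
  · rwa [K4Sub.length_C1]
  · simp only [H]; omega
  · simp only [H, Walk.length_reverse]; omega
  · exact hl₂

/-- Two crossing short jumps, where `x` is the first vertex of `P₁` with a neighbour in the interior
of `P₂` and is not the last internal vertex of `P₁`. -/
lemma IsArcs4.hasK4_of_first_adj (h : IsArcs4 w A B D E) (hG : MemGFam G l) (hl : 2 ≤ l)
    (hw : IsOddHole G w) (hn : List.Nodup [a, b, c, d]) {P₁ : G.Walk a c} {P₂ : G.Walk b d}
    (h₁ : IsShortJump G w P₁) (h₂ : IsShortJump G w P₂) {x z : V} {T : G.Walk a x}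
    {T' : G.Walk x c} (hT : P₁ = T.append T') (hx : x ∈ wInterior P₁) (hz : z ∈ wInterior P₂)
    (hxz : G.Adj x z) (hxc : ¬ G.Adj x c)
    (hfirst : ∀ y ∈ T.support, y ≠ x → ∀ z' ∈ wInterior P₂, ¬ G.Adj y z') :
    HasOddK4 G ∨ HasBalancedK4 G := by
  obtain ⟨-, hl₁⟩ := h.length_jump hG hl hw hn h₁
  obtain ⟨-, hl₂⟩ := h.rotate.length_jump hG hl hw (by grind) h₂
  have hP₁ := h₁.1.2.2.2.2.2.1.1
  have hP₂ := h₂.1.2.2.2.2.2.1.1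
  have hT' : ∀ y ∈ T.support, y ∈ P₁.support := fun y hy => by
    rw [hT]; exact (Walk.mem_support_append_iff _ _).mpr (.inl hy)
  have hTT : ∀ y ∈ T.support, y ∈ T'.support → y = x := fun y hy hy' =>
    (hT ▸ hP₁ : (T.append T').IsPath).eq_of_mem_append hy hy'
  have hTp : T.IsPath := (hT ▸ hP₁ : (T.append T').IsPath).of_append_left
  have hxw : x ∉ w.support := h₁.1.2.2.2.2.2.2 x hx
  have hzw : z ∉ w.support := h₂.1.2.2.2.2.2.2 z hz
  have hlT : P₁.length = T.length + T'.length := by rw [hT, Walk.length_append]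
  have hT'0 : T'.length ≠ 0 := fun h0 => hx.2.2 (Walk.eq_of_length_eq_zero h0)
  have haw := h₁.1.2.1
  have hcw := h₁.1.2.2.1
  have hbw := h₂.1.2.1
  have hdw := h₂.1.2.2.1
  have hTw : ∀ y ∈ T.support, y ∈ w.support → y = a := fun y hy hyw =>
    (h₁.eq_or_eq (hT' y hy) hyw).resolve_right fun r =>
      hx.2.2 (hTT c (r ▸ hy) T'.end_mem_support).symm
  obtain ⟨hab, had⟩ : a ≠ b ∧ a ≠ d := by grind
  have hTP : ∀ y ∈ T.support, y ∉ P₂.support := by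
    intro y hy hy'
    have hyw : y ∉ w.support := fun hyw => by
      have hya := hTw y hy hyw
      rcases h₂.eq_or_eq hy' hyw with r | r
      · exact hab (hya.symm.trans r)
      · exact had (hya.symm.trans r)
    obtain ⟨y', hy1, hy2, hy3⟩ := hTp.exists_adj_pred hy (fun r => hyw (r ▸ haw))
    exact hfirst y' hy1 hy2 y (h₂.mem_wInterior hy' hyw) hy3
  obtain ⟨S₁, S₂, hS₁, hS₂, hS⟩ := hP₂.mem_support_iff_exists_append.mp hz.1
  have hS₁P : ∀ y ∈ S₁.support, y ∈ P₂.support := fun y hy => by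
    rw [hS]; exact (Walk.mem_support_append_iff _ _).mpr (.inl hy)
  have hS₂P : ∀ y ∈ S₂.support, y ∈ P₂.support := fun y hy => by
    rw [hS]; exact (Walk.mem_support_append_iff _ _).mpr (.inr hy)
  have hSS : ∀ y ∈ S₁.support, y ∈ S₂.support → y = z := fun y hy hy' =>
    (hS ▸ hP₂ : (S₁.append S₂).IsPath).eq_of_mem_append hy hy'
  have hS₁w : ∀ y ∈ S₁.support, y ∈ w.support → y = b := fun y hy hyw =>
    (h₂.eq_or_eq (hS₁P y hy) hyw).resolve_right fun r =>
      hz.2.2 (hSS d (r ▸ hy) S₂.end_mem_support).symm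
  have hS₂w : ∀ y ∈ S₂.support, y ∈ w.support → y = d := fun y hy hyw =>
    (h₂.eq_or_eq (hS₂P y hy) hyw).resolve_left fun r =>
      hz.2.1 (hSS b S₁.start_mem_support (r ▸ hy)).symm
  have hlS : P₂.length = S₁.length + S₂.length := by rw [hS, Walk.length_append]
  have hAw : ∀ y ∈ A.support, y ∈ w.support := fun y hy => (h.supp y).mpr (.inl hy)
  have hBDw : ∀ y ∈ (B.append D).support, y ∈ w.support := fun y hy => (h.supp y).mpr <| by
    rw [Walk.mem_support_append_iff] at hy
    tauto
  have hEw : ∀ y ∈ E.support, y ∈ w.support := fun y hy => (h.supp y).mpr (.inr (.inr (.inr hy)))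
  have hTz : ∀ y ∈ (T.concat hxz).support, y ∈ T.support ∨ y = z := fun y hy => by
    simpa [Walk.support_concat] using hy
  have hTcw : ∀ y ∈ (T.concat hxz).support, y ∈ w.support → y = a := fun y hy hyw =>
    hTw y ((hTz y hy).resolve_right fun r : y = z => hzw (r ▸ hyw)) hyw
  have haBD : a ∉ (B.append D).support := fun r => by
    rw [Walk.mem_support_append_iff] at r
    exact r.elim (fun r => h.be a r E.end_mem_support) fun r => h.ad a A.start_mem_support r
  let H : K4Sub G :=
    { u1 := a, u2 := b, u3 := d, u4 := z
      P1 := A, P2 := S₂.reverse, Q1 := B.append D, Q2 := T.concat hxz, L1 := E.reverse, L2 := S₁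
      hu := by
        have : z ≠ a := fun r => hzw (r ▸ haw)
        have : z ≠ b := hz.2.1
        have : z ≠ d := hz.2.2
        grind
      hP1 := h.pathA
      hP2 := hS₂.reverse
      hQ1 := h.pathB.append_of_meet h.pathD h.bd
      hQ2 := hTp.concat (fun r => hTP z r hz.1) hxz
      hL1 := h.pathE.reverse
      hL2 := hS₁
      hP := fun y hy hy' => by
        rw [Walk.support_reverse, List.mem_reverse] at hy'
        exact h.ad y hy (hS₂w y hy' (hAw y hy) ▸ D.end_mem_support)
      hQ := fun y hy hy' => haBD (hTcw y hy' (hBDw y hy) ▸ hy)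
      hL := fun y hy hy' => by
        rw [Walk.support_reverse, List.mem_reverse] at hy
        exact h.be y (hS₁w y hy' (hEw y hy) ▸ B.start_mem_support) hy }
  have hmP : ∀ y ∈ H.P2.support, y ∈ S₂.support := fun y hy => by simpa [H] using hy
  have hmL : ∀ y ∈ H.L1.support, y ∈ E.support := fun y hy => by simpa [H] using hy
  have hE : ∀ e ∈ w.edges, e ∈ H.edges := by
    intro e he
    simp only [H, K4Sub.edges, Set.mem_ofPred_eq, Walk.edges_reverse, List.mem_reverse,
      Walk.edges_append, List.mem_append]
    rcases (h.edge e).mp he with he | he | he | he <;> simp only [he, true_or, or_true]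
  have hE₂ : ∀ e ∈ P₂.edges, e ∈ H.edges := by
    intro e he
    rw [hS, Walk.edges_append, List.mem_append] at he
    simp only [H, K4Sub.edges, Set.mem_ofPred_eq, Walk.edges_reverse, List.mem_reverse]
    rcases he with he | he <;> simp only [he, true_or, or_true]
  have hEx : s(x, z) ∈ H.edges := .inr (.inr (.inr (.inl (by simp [H, Walk.edges_concat]))))
  have hE₁ : ∀ e ∈ T.edges, e ∈ H.edges := fun e he =>
    .inr (.inr (.inr (.inl (by simp [H, Walk.edges_concat, he]))))
  have hverts : ∀ y ∈ H.verts, y ∈ w.support ∨ y ∈ T.support ∨ y ∈ P₂.support := by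
    intro y hy
    rcases hy with hy | hy | hy | hy | hy | hy
    · exact .inl (hAw y hy)
    · exact .inr (.inr (hS₂P y (hmP y hy)))
    · exact .inl (hBDw y hy)
    · exact .inr ((hTz y hy).imp_right fun r : y = z => r ▸ hz.1)
    · exact .inl (hEw y (hmL y hy))
    · exact .inr (.inr (hS₁P y hy))
  have hP₁e : ∀ e, e ∈ P₁.edges ↔ e ∈ T.edges ∨ e ∈ T'.edges := fun e => by
    rw [hT, Walk.edges_append, List.mem_append]
  have hadj : ∀ y ∈ H.verts, ∀ t ∈ H.verts, G.Adj y t → s(y, t) ∈ H.edges := by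
    have hwT : ∀ y ∈ w.support, ∀ t ∈ T.support, G.Adj y t → s(y, t) ∈ H.edges := by
      intro y hy t ht hyt
      rcases h₁.mem_edges hy (hT' t ht) hyt with he | he
      · exact hE _ he
      rcases (hP₁e _).mp he with he | he
      · exact hE₁ _ he
      have hyT' := T'.fst_mem_support_of_mem_edges he
      obtain rfl := hTT t ht (T'.snd_mem_support_of_mem_edges he)
      rcases h₁.eq_or_eq (P₁.fst_mem_support_of_mem_edges ((hP₁e _).mpr (.inr he))) hy with
        rfl | rfl
      · exact absurd (hTT _ T.start_mem_support hyT') hyt.ne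
      · exact absurd hyt.symm hxc
    have hwP : ∀ y ∈ w.support, ∀ t ∈ P₂.support, G.Adj y t → s(y, t) ∈ H.edges :=
      fun y hy t ht hyt => (h₂.mem_edges hy ht hyt).elim (hE _) (hE₂ _)
    have hTTe : ∀ y ∈ T.support, ∀ t ∈ T.support, G.Adj y t → s(y, t) ∈ H.edges := by
      intro y hy t ht hyt
      rcases (hP₁e _).mp (h₁.1.2.2.2.2.2.1.2 y (hT' y hy) t (hT' t ht) hyt) with he | he
      · exact hE₁ _ he
      · exact absurd ((hTT y hy (T'.fst_mem_support_of_mem_edges he)).trans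
          (hTT t ht (T'.snd_mem_support_of_mem_edges he)).symm) hyt.ne
    have hTPe : ∀ y ∈ T.support, ∀ t ∈ P₂.support, G.Adj y t → s(y, t) ∈ H.edges := by
      intro y hy t ht hyt
      by_cases htw : t ∈ w.support
      · rw [Sym2.eq_swap]
        exact hwT t htw y hy hyt.symm
      have hti := h₂.mem_wInterior ht htw
      by_cases hyx : y = x
      · subst hyx
        obtain rfl := hG.eq_of_adj_interior hP₂ hl₂ (hTP y hy) hti hz hyt hxz
        exact hEx
      · exact absurd hyt (hfirst y hy hyx t hti)
    intro y hy t ht hyt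
    rcases hverts y hy with hy | hy | hy <;> rcases hverts t ht with ht | ht | ht
    · exact hE _ (hw.1.2.2 y hy t ht hyt)
    · exact hwT y hy t ht hyt
    · exact hwP y hy t ht hyt
    · rw [Sym2.eq_swap]
      exact hwT t ht y hy hyt.symm
    · exact hTTe y hy t ht hyt
    · exact hTPe y hy t ht hyt
    · rw [Sym2.eq_swap]
      exact hwP t ht y hy hyt.symm
    · rw [Sym2.eq_swap]
      exact hTPe t ht y hy hyt.symm
    · exact hE₂ _ (h₂.1.2.2.2.2.2.1.2 y hy t ht hyt)
  have hH : H.IsInduced :=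
    { p1q1 := fun y hy hy' => ((Walk.mem_support_append_iff _ _).mp hy').elim (h.ab y hy)
        fun r => absurd r (h.ad y hy)
      p1l1 := fun y hy hy' => h.ea y (hmL y hy') hy
      q1l1 := fun y hy hy' => ((Walk.mem_support_append_iff _ _).mp hy).elim
        (fun r => absurd (hmL y hy') (h.be y r)) fun r => h.de y r (hmL y hy')
      p1q2 := fun y hy hy' => hTcw y hy' (hAw y hy)
      p1l2 := fun y hy hy' => hS₁w y hy' (hAw y hy)
      q2l2 := fun y hy hy' => (hTz y hy).resolve_left fun r => hTP y r (hS₁P y hy')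
      p2q1 := fun y hy hy' => hS₂w y (hmP y hy) (hBDw y hy')
      p2l2 := fun y hy hy' => hSS y hy' (hmP y hy)
      q1l2 := fun y hy hy' => hS₁w y hy' (hBDw y hy)
      p2q2 := fun y hy hy' => (hTz y hy').resolve_left fun r => hTP y r (hS₂P y (hmP y hy))
      p2l1 := fun y hy hy' => hS₂w y (hmP y hy) (hEw y (hmL y hy'))
      q2l1 := fun y hy hy' => hTcw y hy (hEw y (hmL y hy'))
      adj := hadj }
  refine hH.hasOddK4_or_hasBalancedK4 hG hl ?_ ?_ ?_ ?_
  · rw [K4Sub.length_C1]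
    simp only [H, Walk.length_append, Walk.length_reverse]
    rw [← add_assoc, ← h.len]
    exact hw.2
  · simp only [H, Walk.length_reverse]; omega
  · simp only [H, Walk.length_concat]; omega
  · simp only [H]; omega

end Crossing
/-- If `P1`, `P2` are crossing short jumps over the odd hole `w`,
then `G` contains an odd `K4`-subdivision or a balanced `K4`-subdivision of
type `(1,2)`. -/
theorem crossing_short_jumps {V : Type*} [Fintype V]
    (l : ℕ) (hl : 4 ≤ l) (G : SimpleGraph V) (hG : MemGFam G l)
    {v u1 v1 u2 v2 : V} (w : G.Walk v v) (hw : IsOddHole G w)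
    (P1 : G.Walk u1 v1) (P2 : G.Walk u2 v2)
    (h1 : IsShortJump G w P1) (h2 : IsShortJump G w P2)
    (hdist : List.Nodup [u1, v1, u2, v2]) (hcross : CyclicOrder4 G w u1 u2 v1 v2) :
    HasOddK4 G ∨ HasBalancedK4 G := by
  obtain ⟨A, B, D, E, h⟩ := exists_isArcs4 hw.1.1 (by grind) hcross
  have hn : List.Nodup [u1, u2, v1, v2] := by grind
  have hn' : List.Nodup [v1, v2, u1, u2] := by grind
  have hl2 : 2 ≤ l := by omega
  obtain ⟨hc1, hc2⟩ : v1 ≠ u2 ∧ v1 ≠ v2 := by grind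
  obtain ⟨ha1, ha2⟩ : u1 ≠ u2 ∧ u1 ≠ v2 := by grind
  by_cases hno : ∀ y ∈ wInterior P1, ∀ z ∈ wInterior P2, ¬ G.Adj y z
  · by_cases hodd : Odd (A.length + B.length + P1.length)
    · exact h.hasK4_of_not_adj hG hl2 hw hn h1 h2 hno hodd
    · refine h.rotate.rotate.hasK4_of_not_adj hG hl2 hw hn' h1.reverse h2.reverse ?_ ?_
      · rwa [wInterior_reverse, wInterior_reverse]
      · have hw2 := hw.2
        rw [h.len] at hw2
        rw [Walk.length_reverse]
        grind
  push Not at hno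
  obtain ⟨y, hy, z₀, hz₀, hyz⟩ := hno
  obtain ⟨x, T, T', hT, ⟨hx, z, hz, hxz⟩, hR⟩ := P1.exists_first
    (fun y => y ∈ wInterior P1 ∧ ∃ z ∈ wInterior P2, G.Adj y z) ⟨y, hy.1, hy, z₀, hz₀, hyz⟩
  have hP1 := h1.1.2.2.2.2.2.1.1
  have hu1 := h2.2 u1 h1.1.2.1 ha1 ha2
  have hv1 := h2.2 v1 h1.1.2.2.1 hc1 hc2
  by_cases hxc : G.Adj x v1
  · have hTT : ∀ y ∈ T.support, y ∈ T'.support → y = x := fun y hy hy' =>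
      (hT ▸ hP1 : (T.append T').IsPath).eq_of_mem_append hy hy'
    have hTp : T.IsPath := (hT ▸ hP1 : (T.append T').IsPath).of_append_left
    have hT'p : T'.IsPath := (hT ▸ hP1 : (T.append T').IsPath).of_append_right
    have hP1e : ∀ e ∈ P1.edges, e ∈ T.edges ∨ e ∈ T'.edges := fun e he => by
      rwa [hT, Walk.edges_append, List.mem_append] at he
    have hlT : P1.length = T.length + T'.length := by rw [hT, Walk.length_append]
    have h3 := (h.length_jump hG hl2 hw hn h1).1
    have hT'1 : T'.length = 1 := by
      refine hT'p.length_eq_one_of_mem_edges ((hP1e _ (h1.1.2.2.2.2.2.1.2 x hx.1 v1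
        P1.end_mem_support hxc)).resolve_left fun r => ?_)
      exact hx.2.2 (hTT v1 (T.snd_mem_support_of_mem_edges r) T'.end_mem_support).symm
    have hxa : ¬ G.Adj x u1 := fun hxa => by
      have hT1 : T.length = 1 := by
        refine hTp.length_eq_one_of_mem_edges ((hP1e _ (h1.1.2.2.2.2.2.1.2 u1
          P1.start_mem_support x hx.1 hxa.symm)).resolve_right fun r => ?_)
        exact hx.2.1 (hTT u1 T.start_mem_support (T'.fst_mem_support_of_mem_edges r)).symm
      omega
    refine h.rotate.rotate.hasK4_of_first_adj hG hl2 hw hn' h1.reverse h2.reverse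
      (T := T'.reverse) (T' := T.reverse) (by rw [hT, Walk.reverse_append])
      (by rwa [wInterior_reverse]) (by rwa [wInterior_reverse]) hxz hxa ?_
    rw [wInterior_reverse]
    intro y hy hyx
    obtain rfl : y = v1 := by
      rw [Walk.support_reverse, List.mem_reverse] at hy
      cases T' with
      | nil => simp at hT'1
      | cons e T' =>
        cases T' with
        | nil => simpa [hyx] using hy
        | cons => simp at hT'1
    exact hv1
  · refine h.hasK4_of_first_adj hG hl2 hw hn h1 h2 hT hx hz hxz hxc ?_
    intro y hy hyx z' hz' hyz'
    have hyP : y ∈ P1.support := by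
      rw [hT]
      exact (Walk.mem_support_append_iff _ _).mpr (.inl hy)
    refine hR y hy hyx ⟨⟨hyP, ?_, ?_⟩, z', hz', hyz'⟩
    · rintro rfl
      exact hu1 z' hz' hyz'
    · rintro rfl
      exact hv1 z' hz' hyz'
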